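/- arXiv:1407.1169 — 2 statements merged into one kernel-verified Lean document; each statement's English description precedes it below -/
import Mathlib

section
/- Let H be a Hermitian N×N complex matrix whose vector of eigenvalues (with multiplicity) is y, and let x be a real vector of length N with x ≺ y. Then there exists a unitary matrix V of order N such that the diagonal of V H V† equals x, i.e. (V H V†)_{ii} = x_i for all i. -/
open Matrix

/-- `Majorized x y` means `x ≺ y`: every partial sum of entries of `x` (over any set of
indices) is dominated by the sum of `y` over some set of indices of the same cardinality
(equivalently, sums of the `m` largest entries are ordered), and total sums agree. -/
def Majorized {N : ℕ} (x y : Fin N → ℝ) : Prop :=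
  (∀ s : Finset (Fin N), ∃ t : Finset (Fin N), t.card = s.card ∧
      ∑ i ∈ s, x i ≤ ∑ i ∈ t, y i) ∧
  ∑ i, x i = ∑ i, y i

/-- The vector `d` is the diagonal of some unitary conjugate of `H`. -/
def IsConjDiagonal {N : ℕ} (H : Matrix (Fin N) (Fin N) ℂ) (d : Fin N → ℝ) : Prop :=
  ∃ V ∈ Matrix.unitaryGroup (Fin N) ℂ, ∀ i, (V * H * Vᴴ) i i = (d i : ℂ)

lemma mul_mul_conjTranspose_apply {N : ℕ} (V H : Matrix (Fin N) (Fin N) ℂ) (i l : Fin N) :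
    (V * H * Vᴴ) i l = (V i ᵥ* H) ⬝ᵥ star (V l) := by
  rw [Matrix.mul_apply]
  rfl

lemma mem_unitaryGroup_iff_rows {N : ℕ} (V : Matrix (Fin N) (Fin N) ℂ) :
    V ∈ Matrix.unitaryGroup (Fin N) ℂ ↔
      ∀ i l, V i ⬝ᵥ star (V l) = if i = l then 1 else 0 := by
  rw [Matrix.mem_unitaryGroup_iff, ← Matrix.ext_iff]
  simp only [Matrix.one_apply]
  rfl

/-- The eigenvalue vector is the diagonal of a unitary conjugate. -/
lemma isConjDiagonal_eigenvalues {N : ℕ} {H : Matrix (Fin N) (Fin N) ℂ} (hH : H.IsHermitian) :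
    IsConjDiagonal H hH.eigenvalues := by
  refine ⟨star (hH.eigenvectorUnitary : Matrix (Fin N) (Fin N) ℂ),
    (star hH.eigenvectorUnitary).2, fun i => ?_⟩
  have h := hH.conjStarAlgAut_star_eigenvectorUnitary
  rw [Unitary.conjStarAlgAut_apply] at h
  have h' := congrFun (congrFun h i) i
  simpa [Matrix.star_eq_conjTranspose] using h'

lemma IsConjDiagonal.comp_perm {N : ℕ} {H : Matrix (Fin N) (Fin N) ℂ} {d : Fin N → ℝ}
    (hd : IsConjDiagonal H d) (σ : Equiv.Perm (Fin N)) : IsConjDiagonal H (d ∘ σ) := by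
  obtain ⟨V, hV, h⟩ := hd
  refine ⟨V.submatrix σ id, ?_, fun i => ?_⟩
  · rw [mem_unitaryGroup_iff_rows] at hV ⊢
    intro i l
    have h' := hV (σ i) (σ l)
    simp only [σ.injective.eq_iff] at h'
    exact h'
  · have h' := h (σ i)
    rw [mul_mul_conjTranspose_apply] at h' ⊢
    exact h'

lemma exists_norm_one_mul_re_eq_zero (a : ℂ) :
    ∃ z : ℂ, z * star z = 1 ∧ star z * a + z * star a = 0 := by
  obtain rfl | ha := eq_or_ne a 0
  · exact ⟨1, by simp, by simp⟩
  · have hn : (‖a‖ : ℂ) ≠ 0 := by simpa using ha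
    have key : a * star a = (‖a‖ : ℂ) ^ 2 := Complex.mul_conj' a
    refine ⟨Complex.I * a / ‖a‖, ?_, ?_⟩
    · simp only [star_div₀, star_mul', Complex.star_def, Complex.conj_I, Complex.conj_ofReal]
        at key ⊢
      field_simp
      linear_combination (-(Complex.I ^ 2)) * key - (‖a‖ : ℂ) ^ 2 * Complex.I_sq
    · simp only [star_div₀, star_mul', Complex.star_def, Complex.conj_I, Complex.conj_ofReal]
      ring

/-- The diagonals of unitary conjugates of a Hermitian matrix are closed under averaging two
entries towards each other. -/
lemma IsConjDiagonal.transfer {N : ℕ} {H : Matrix (Fin N) (Fin N) ℂ} (hH : H.IsHermitian)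
    {d : Fin N → ℝ} (hd : IsConjDiagonal H d) {j k : Fin N} (hjk : j ≠ k) {t : ℝ}
    (ht0 : 0 ≤ t) (ht1 : t ≤ 1) :
    IsConjDiagonal H (Function.update (Function.update d j ((1 - t) * d j + t * d k)) k
      (t * d j + (1 - t) * d k)) := by
  obtain ⟨V, hV, h⟩ := hd
  rw [mem_unitaryGroup_iff_rows] at hV
  obtain ⟨z, hz, hza⟩ := exists_norm_one_mul_re_eq_zero ((V * H * Vᴴ) j k)
  have hsymm : star ((V * H * Vᴴ) j k) = (V * H * Vᴴ) k j :=
    (Matrix.isHermitian_mul_mul_conjTranspose V hH).apply k j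
  rw [hsymm] at hza
  simp only [mul_mul_conjTranspose_apply] at h hza
  obtain ⟨c, hc⟩ : ∃ c : ℝ, c * c = 1 - t := ⟨√(1 - t), Real.mul_self_sqrt (by linarith)⟩
  obtain ⟨s, hs⟩ : ∃ s : ℝ, s * s = t := ⟨√t, Real.mul_self_sqrt ht0⟩
  have hc' : (c : ℂ) * c = 1 - t := by exact_mod_cast hc
  have hs' : (s : ℂ) * s = t := by exact_mod_cast hs
  set W : Matrix (Fin N) (Fin N) ℂ := fun i =>
    if i = j then (c : ℂ) • V j + (s * z) • V k
    else if i = k then (-(s * star z)) • V j + (c : ℂ) • V k else V i with hW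
  have hWj : W j = (c : ℂ) • V j + (s * z) • V k := by simp [hW]
  have hWk : W k = (-(s * star z)) • V j + (c : ℂ) • V k := by simp [hW, hjk.symm]
  have hWi : ∀ i, i ≠ j → i ≠ k → W i = V i := fun i h₁ h₂ => by simp [hW, h₁, h₂]
  have hcs : star (c : ℂ) = c := Complex.conj_ofReal c
  have hss : star (s : ℂ) = s := Complex.conj_ofReal s
  refine ⟨W, ?_, fun i => ?_⟩
  · rw [mem_unitaryGroup_iff_rows]
    intro i l
    have hz' : z * (starRingEnd ℂ) z = 1 := hz
    have hone : (c : ℂ) * c + s * s = 1 := by rw [hc', hs']; ring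
    rcases eq_or_ne i j with rfl | hij
    · rcases eq_or_ne l i with rfl | hli
      · simp [hWj, hV, hjk, hjk.symm]
        linear_combination hone + (s * s : ℂ) * hz'
      · rcases eq_or_ne l k with rfl | hlk
        · simp [hWj, hWk, hV, hjk, hjk.symm]
          ring
        · simp [hWj, hWi l hli hlk, hV, hli.symm, hlk.symm]
    · rcases eq_or_ne i k with rfl | hik
      · rcases eq_or_ne l j with rfl | hlj
        · simp [hWj, hWk, hV, hjk, hjk.symm]
          ring
        · rcases eq_or_ne l i with rfl | hli
          · simp [hWk, hV, hjk, hjk.symm]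
            linear_combination hone + (s * s : ℂ) * hz'
          · simp [hWk, hWi l hlj hli, hV, hli.symm, hlj.symm]
      · rcases eq_or_ne l j with rfl | hlj
        · simp [hWj, hWi i hij hik, hV, hij, hik]
        · rcases eq_or_ne l k with rfl | hlk
          · simp [hWk, hWi i hij hik, hV, hij, hik]
          · rw [hWi i hij hik, hWi l hlj hlk, hV]
  · rw [mul_mul_conjTranspose_apply]
    by_cases hik : i = k
    · subst hik
      rw [hWk]
      simp only [Matrix.add_vecMul, Matrix.smul_vecMul, add_dotProduct, dotProduct_add, star_add,
        star_smul, smul_dotProduct, dotProduct_smul, smul_eq_mul, h, Function.update_self,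
        star_neg, star_mul', star_star, hcs, hss]
      push_cast
      linear_combination (s * s * d j : ℂ) * hz + (d j : ℂ) * hs' + (d i : ℂ) * hc' - c * s * hza
    · by_cases hij : i = j
      · subst hij
        rw [hWj]
        simp only [Matrix.add_vecMul, Matrix.smul_vecMul, add_dotProduct, dotProduct_add, star_add,
          star_smul, smul_dotProduct, dotProduct_smul, smul_eq_mul, h, Function.update_self,
          Function.update_of_ne hik, star_mul', hcs, hss]
        push_cast
        linear_combination (s * s * d k : ℂ) * hz + (d k : ℂ) * hs' + (d i : ℂ) * hc' + c * s * hza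
      · rw [hWi i hij hik, Function.update_of_ne hik, Function.update_of_ne hij, h]

/-- If `x` is antitone and its initial sums are dominated by those of `d`, then `x` is reached
from `d` by averaging pairs of entries. -/
lemma of_transfer_of_sum_Iic_le {N : ℕ} {P : (Fin N → ℝ) → Prop}
    (hP : ∀ (d : Fin N → ℝ) (j k : Fin N) (t : ℝ), j ≠ k → 0 ≤ t → t ≤ 1 → P d →
      P (Function.update (Function.update d j ((1 - t) * d j + t * d k)) k
        (t * d j + (1 - t) * d k)))
    {x : Fin N → ℝ} (hx : Antitone x) (d : Fin N → ℝ) (hd : P d)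
    (hle : ∀ a, ∑ i ∈ Finset.Iic a, x i ≤ ∑ i ∈ Finset.Iic a, d i)
    (hsum : ∑ i, x i = ∑ i, d i) : P x := by
  induction hn : (Finset.univ.filter fun i => d i ≠ x i).card using Nat.strong_induction_on
    generalizing d with
  | _ n ih =>
  by_cases hk : ∃ k, d k < x k
  swap
  · push Not at hk
    have hxd : x = d := by
      funext i
      exact (Finset.sum_eq_sum_iff_of_le fun i _ => hk i).1 hsum i (Finset.mem_univ i)
    rwa [hxd]
  obtain ⟨k, hk, hkmin⟩ : ∃ k, d k < x k ∧ ∀ i < k, x i ≤ d i := by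
    obtain ⟨k, hk, hmin⟩ := WellFounded.has_min (wellFounded_lt (α := Fin N))
      {k | d k < x k} hk
    exact ⟨k, hk, fun i hi => not_lt.1 fun h => hmin i h hi⟩
  obtain ⟨j, hjk, hj⟩ : ∃ j, j < k ∧ x j < d j := by
    by_contra! hcon
    refine absurd (hle k) (not_le.2 (Finset.sum_lt_sum (fun i hi => ?_) ⟨k, by simp, hk⟩))
    obtain rfl | hi := (Finset.mem_Iic.1 hi).eq_or_lt
    · exact hk.le
    · exact hcon i hi
  have hxjk := hx hjk.le
  have hpos : 0 < d j - d k := by linarith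
  obtain ⟨δ, hδ, hδj, hδk, hδe⟩ : ∃ δ, 0 < δ ∧ δ ≤ d j - x j ∧ δ ≤ x k - d k ∧
      (δ = d j - x j ∨ δ = x k - d k) :=
    ⟨min (d j - x j) (x k - d k), lt_min (by linarith) (by linarith), min_le_left _ _,
      min_le_right _ _, min_choice _ _⟩
  have hmul : δ / (d j - d k) * (d j - d k) = δ := div_mul_cancel₀ _ hpos.ne'
  have hP' := hP d j k (δ / (d j - d k)) hjk.ne (by positivity)
    ((div_le_one hpos).2 (by linarith)) hd
  rw [show (1 - δ / (d j - d k)) * d j + δ / (d j - d k) * d k = d j - δ by linarith,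
    show δ / (d j - d k) * d j + (1 - δ / (d j - d k)) * d k = d k + δ by linarith] at hP'
  set e := Function.update (Function.update d j (d j - δ)) k (d k + δ) with he
  have hek : e k = d k + δ := by simp [he]
  have hej : e j = d j - δ := by simp [he, hjk.ne]
  have hei : ∀ i, i ≠ j → i ≠ k → e i = d i := fun i h₁ h₂ => by simp [he, h₁, h₂]
  have hform : ∀ i, e i = d i + ((if i = k then δ else 0) - if i = j then δ else 0) := by
    intro i
    by_cases hik : i = k
    · subst hik; simp [hek, hjk.ne']
    · by_cases hij : i = j
      · subst hij; simp [hej, hik, sub_eq_add_neg]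
      · simp [hei i hij hik, hij, hik]
  refine ih _ ?_ e hP' (fun a => ?_) ?_ rfl
  · rw [← hn]
    refine Finset.card_lt_card ((Finset.ssubset_iff_of_subset fun i hi => ?_).2 ?_)
    · simp only [Finset.mem_filter, Finset.mem_univ, true_and] at hi ⊢
      by_cases hik : i = k
      · subst hik; exact hk.ne
      · by_cases hij : i = j
        · subst hij; exact hj.ne'
        · rwa [hei i hij hik] at hi
    · obtain h | h := hδe
      · exact ⟨j, by simpa using hj.ne', by simp [hej, h]⟩
      · exact ⟨k, by simpa using hk.ne, by simp [hek, h]⟩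
  · by_cases hmid : j ≤ a ∧ a < k
    · have hxe : ∀ i ∈ Finset.Iic a, x i ≤ e i := by
        intro i hi
        have hik : i < k := (Finset.mem_Iic.1 hi).trans_lt hmid.2
        by_cases hij : i = j
        · subst hij; linarith
        · rw [hei i hij hik.ne]; exact hkmin i hik
      exact Finset.sum_le_sum hxe
    · have : ∑ i ∈ Finset.Iic a, e i = ∑ i ∈ Finset.Iic a, d i := by
        simp only [hform, Finset.sum_add_distrib, Finset.sum_sub_distrib, Finset.sum_ite_eq',
          Finset.mem_Iic]
        have : k ≤ a ↔ j ≤ a :=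
          ⟨fun h => hjk.le.trans h, fun h => not_lt.1 fun hak => hmid ⟨h, hak⟩⟩
        simp [this]
      rw [this]
      exact hle a
  · rw [hsum]
    simp [hform, Finset.sum_add_distrib]

/-- The first entries of an antitone vector have the largest sum among sets of the same size. -/
lemma Antitone.sum_le_sum_Iic {N : ℕ} {d : Fin N → ℝ} (hd : Antitone d) (a : Fin N)
    (t : Finset (Fin N)) (ht : t.card = (Finset.Iic a).card) :
    ∑ i ∈ t, d i ≤ ∑ i ∈ Finset.Iic a, d i := by
  have h₁ : ∑ i ∈ t \ Finset.Iic a, d i ≤ (t \ Finset.Iic a).card • d a :=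
    Finset.sum_le_card_nsmul _ _ _ fun i hi => hd (by simp at hi; exact hi.2.le)
  have h₂ : (Finset.Iic a \ t).card • d a ≤ ∑ i ∈ Finset.Iic a \ t, d i :=
    Finset.card_nsmul_le_sum _ _ _ fun i hi => hd (by simp at hi; exact hi.1)
  rw [Finset.card_sdiff_comm ht] at h₁
  rw [← Finset.sum_inter_add_sum_sdiff t (Finset.Iic a),
    ← Finset.sum_inter_add_sum_sdiff (Finset.Iic a) t, Finset.inter_comm]
  linarith

lemma Majorized.comp_perm {N : ℕ} {x y : Fin N → ℝ} (h : Majorized x y)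
    (σ τ : Equiv.Perm (Fin N)) : Majorized (x ∘ σ) (y ∘ τ) := by
  refine ⟨fun s => ?_, ?_⟩
  · obtain ⟨t, ht, hle⟩ := h.1 (s.map σ.toEmbedding)
    refine ⟨t.map τ.symm.toEmbedding, by simpa using ht, ?_⟩
    simpa using hle
  · simpa [Equiv.sum_comp] using h.2

lemma exists_perm_antitone_comp {N : ℕ} (x : Fin N → ℝ) :
    ∃ σ : Equiv.Perm (Fin N), Antitone (x ∘ σ) :=
  ⟨Tuple.sort (-x), fun i j hij => by simpa using Tuple.monotone_sort (-x) hij⟩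

/-- If `H` is Hermitian with eigenvalue vector `y` and `x ≺ y`, then some
unitary `V` makes the diagonal of `V * H * Vᴴ` equal to `x`. -/
theorem exists_unitary_with_prescribed_diagonal (N : ℕ)
    (H : Matrix (Fin N) (Fin N) ℂ) (hH : H.IsHermitian)
    (x : Fin N → ℝ) (hx : Majorized x hH.eigenvalues) :
    ∃ V ∈ Matrix.unitaryGroup (Fin N) ℂ,
      ∀ i, (V * H * Vᴴ) i i = (x i : ℂ) := by
  obtain ⟨σ, hσ⟩ := exists_perm_antitone_comp x
  obtain ⟨τ, hτ⟩ := exists_perm_antitone_comp hH.eigenvalues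
  have hmaj := hx.comp_perm σ τ
  have hdiag : IsConjDiagonal H (x ∘ σ) := by
    refine of_transfer_of_sum_Iic_le (fun d j k t hjk ht0 ht1 hd => hd.transfer hH hjk ht0 ht1) hσ
      _ ((isConjDiagonal_eigenvalues hH).comp_perm τ) (fun a => ?_) hmaj.2
    obtain ⟨t, ht, hle⟩ := hmaj.1 (Finset.Iic a)
    exact hle.trans (hτ.sum_le_sum_Iic a t ht)
  have hfinal := hdiag.comp_perm σ.symm
  rwa [Function.comp_assoc, Equiv.self_comp_symm, Function.comp_id] at hfinal
end

section
/- Let H be a positive semidefinite Hermitian N×N complex matrix. Then for every unitary matrix V of order N, the product of the (real, nonnegative) diagonal entries of V H V† is at most (Tr H / N)^N, and there exists a unitary V attaining this bound (namely V = F U with U H U† diagonal and F a complex Hadamard matrix, which makes V H V† contradiagonal). Hence the product of the diagonal entries over the unitary orbit of H is maximal exactly at the contradiagonal form. -/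
open Matrix ComplexOrder

/-- **AM-GM** for a finite family: the product is at most the mean to the power of the
cardinality. -/
theorem prod_le_sum_div_card_pow {ι : Type*} [Fintype ι] [Nonempty ι] (z : ι → ℝ)
    (hz : ∀ i, 0 ≤ z i) :
    ∏ i, z i ≤ ((∑ i, z i) / Fintype.card ι) ^ Fintype.card ι := by
  have hcard : Fintype.card ι ≠ 0 := Fintype.card_ne_zero
  have amgm := Real.geom_mean_le_arith_mean Finset.univ (fun _ => 1) z (fun _ _ => zero_le_one)
    (by simpa using Fintype.card_pos) (fun i _ => hz i)
  simp only [Real.rpow_one, one_mul, Finset.sum_const, Finset.card_univ, nsmul_eq_mul,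
    mul_one] at amgm
  have hprod : 0 ≤ ∏ i, z i := Finset.prod_nonneg fun i _ => hz i
  calc ∏ i, z i = ((∏ i, z i) ^ (Fintype.card ι : ℝ)⁻¹) ^ Fintype.card ι :=
        (Real.rpow_inv_natCast_pow hprod hcard).symm
    _ ≤ _ := pow_le_pow_left₀ (Real.rpow_nonneg hprod _) amgm _

/-- There is a complex Hadamard matrix of every positive order (the Fourier matrix). -/
theorem exists_unitary_mul_star_eq_inv (N : ℕ) (hN : N ≠ 0) :
    ∃ F ∈ Matrix.unitaryGroup (Fin N) ℂ, ∀ j k, F j k * star (F j k) = (N : ℂ)⁻¹ := by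
  obtain ⟨ζ, hζ⟩ : ∃ ζ : ℂ, IsPrimitiveRoot ζ N := ⟨_, Complex.isPrimitiveRoot_exp N hN⟩
  have hN' : (N : ℂ) ≠ 0 := Nat.cast_ne_zero.mpr hN
  have hζ_star : ζ * star ζ = 1 := by
    simpa [hζ.norm'_eq_one hN] using Complex.mul_conj' ζ
  have hsqrt : ((Real.sqrt N : ℝ) : ℂ)⁻¹ * ((Real.sqrt N : ℝ) : ℂ)⁻¹ = (N : ℂ)⁻¹ := by
    rw [← mul_inv, ← Complex.ofReal_mul, Real.mul_self_sqrt N.cast_nonneg, Complex.ofReal_natCast]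
  have hentry (j l k : ℕ) :
      ((Real.sqrt N : ℝ) : ℂ)⁻¹ * ζ ^ (j * k) * star (((Real.sqrt N : ℝ) : ℂ)⁻¹ * ζ ^ (l * k)) =
        (N : ℂ)⁻¹ * (ζ ^ j * star ζ ^ l) ^ k := by
    rw [← hsqrt, star_mul', star_pow, mul_pow, ← pow_mul, ← pow_mul, star_inv₀]
    simp only [Complex.star_def, Complex.conj_ofReal]
    ring
  have hdiag (j : ℕ) : ζ ^ j * star ζ ^ j = 1 := by rw [← mul_pow, hζ_star, one_pow]
  refine ⟨Matrix.of fun j k => ((Real.sqrt N : ℝ) : ℂ)⁻¹ * ζ ^ (j.val * k.val), ?_, ?_⟩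
  · rw [Matrix.mem_unitaryGroup_iff]
    ext j l
    simp only [Matrix.mul_apply, Matrix.star_apply, Matrix.of_apply, hentry, ← Finset.mul_sum]
    rw [Fin.sum_univ_eq_sum_range (fun k => (ζ ^ j.val * star ζ ^ l.val) ^ k) N]
    rcases eq_or_ne j l with rfl | hjl
    · rw [hdiag]
      simp [hN']
    · have hne : ζ ^ j.val * star ζ ^ l.val ≠ 1 := fun h => hjl <| Fin.ext <|
        hζ.pow_inj j.isLt l.isLt <| mul_right_cancel₀
          (right_ne_zero_of_mul_eq_one (hdiag l)) (h.trans (hdiag l).symm)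
      have hpow : (ζ ^ j.val * star ζ ^ l.val) ^ N = 1 := by
        rw [mul_pow, pow_right_comm, pow_right_comm (star ζ), ← star_pow, hζ.pow_eq_one]
        simp
      rw [geom_sum_eq hne, hpow, Matrix.one_apply_ne hjl]
      simp
  · intro j k
    simp only [Matrix.of_apply, hentry, hdiag, one_pow, mul_one]

/-- Every Hermitian matrix is unitarily equivalent to a contradiagonal one. -/
theorem Matrix.IsHermitian.exists_unitary_contradiagonal {N : ℕ} (hN : N ≠ 0)
    {H : Matrix (Fin N) (Fin N) ℂ} (hH : H.IsHermitian) :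
    ∃ V ∈ Matrix.unitaryGroup (Fin N) ℂ, ∀ i, (V * H * Vᴴ) i i = Matrix.trace H / N := by
  obtain ⟨F, hF, hF_entry⟩ := exists_unitary_mul_star_eq_inv N hN
  refine ⟨F * (star hH.eigenvectorUnitary : Matrix.unitaryGroup (Fin N) ℂ),
    mul_mem hF (SetLike.coe_mem _), fun i => ?_⟩
  have hdiag := hH.conjStarAlgAut_star_eigenvectorUnitary
  rw [Unitary.conjStarAlgAut_apply] at hdiag
  rw [Matrix.conjTranspose_mul, ← Matrix.star_eq_conjTranspose, ← Matrix.star_eq_conjTranspose,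
    ← mul_assoc, mul_assoc F, mul_assoc F, hdiag, hH.trace_eq_sum_eigenvalues, Finset.sum_div,
    Matrix.mul_apply]
  refine Finset.sum_congr rfl fun k _ => ?_
  rw [Matrix.mul_diagonal, Matrix.star_apply, mul_right_comm, hF_entry, div_eq_inv_mul]
  rfl

/-- for a positive semidefinite Hermitian `H`, the product of the diagonal
entries of `V H Vᴴ` is at most `(Tr H / N)^N` for every unitary `V`, and the bound is
attained by some unitary `V` which moreover makes `V H Vᴴ` contradiagonal. -/
theorem diag_product_max_at_contradiagonal (N : ℕ) (hN : 0 < N)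
    (H : Matrix (Fin N) (Fin N) ℂ) (hH : H.PosSemidef) :
    (∀ V ∈ Matrix.unitaryGroup (Fin N) ℂ,
        ∏ i, ((V * H * Vᴴ) i i).re ≤ ((Matrix.trace H).re / N) ^ N) ∧
    (∃ V ∈ Matrix.unitaryGroup (Fin N) ℂ,
        (∀ i, (V * H * Vᴴ) i i = Matrix.trace H / N) ∧
        ∏ i, ((V * H * Vᴴ) i i).re = ((Matrix.trace H).re / N) ^ N) := by
  have : NeZero N := ⟨hN.ne'⟩
  refine ⟨fun V hV => ?_, ?_⟩
  · have hdiag (i : Fin N) : 0 ≤ ((V * H * Vᴴ) i i).re :=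
      (Complex.nonneg_iff.mp (hH.mul_mul_conjTranspose_same V).diag_nonneg).1
    have htrace : ∑ i, ((V * H * Vᴴ) i i).re = (Matrix.trace H).re := by
      rw [← Complex.re_sum]
      change (Matrix.trace (V * H * Vᴴ)).re = _
      rw [Matrix.trace_mul_comm, ← mul_assoc, ← Matrix.star_eq_conjTranspose,
        Matrix.mem_unitaryGroup_iff'.mp hV, one_mul]
    simpa [htrace] using prod_le_sum_div_card_pow _ hdiag
  · obtain ⟨V, hV, hdiag⟩ := hH.isHermitian.exists_unitary_contradiagonal hN.ne'
    exact ⟨V, hV, hdiag, by simp [hdiag, div_pow]⟩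
end
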